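/- Let (Γ_n) be a sequence of finite connected vertex-transitive graphs of diverging sizes n with uniformly bounded degree satisfying D² = o(n/log n), with f(n) defined by n = D²f(n). Fix k ≥ 1. Then uniformly over sets A of vertices with |A| = k, E_π(T_A) = E_α(T_A)·(1 + O(1/f(n))), where α = α_A is the quasi-stationary distribution associated with A. -/

import Mathlib

open MeasureTheory Filter

noncomputable section

/-- Heat kernel (transition semigroup) of the continuous-time rate-1 Markov chain with
one-step transition matrix `K`, given by the uniformization formula
`p_t = e^{-t} ∑_k (t^k/k!) K^k`. -/
def heatKer {V : Type} [Fintype V] [DecidableEq V] (K : Matrix V V ℝ) (t : ℝ) (x y : V) : ℝ :=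
  ∑' k : ℕ, Real.exp (-t) * t ^ k / (Nat.factorial k : ℝ) * (K ^ k) x y

/-- A continuous-time Markov chain with jump matrix `K`: a family of path measures `P x`
(for the chain started at `x`), with right-continuous paths, whose finite-dimensional
distributions are given by the heat kernel of `K`. -/
structure CTMC (V : Type) [Fintype V] [DecidableEq V] (K : Matrix V V ℝ) where
  Ω : Type
  mΩ : MeasurableSpace Ω
  P : V → @Measure Ω mΩ
  prob : ∀ x, IsProbabilityMeasure (P x)
  X : ℝ → Ω → V
  measX : ∀ (t : ℝ) (y : V), MeasurableSet[mΩ] {ω | X t ω = y}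
  rightCts : ∀ (ω : Ω) (t : ℝ), ∃ ε > 0, ∀ s, t ≤ s → s < t + ε → X s ω = X t ω
  fdd : ∀ (x : V) (n : ℕ) (t : Fin (n + 1) → ℝ), Monotone t → t 0 = 0 →
    ∀ y : Fin (n + 1) → V,
      P x {ω | ∀ i, X (t i) ω = y i} =
        ENNReal.ofReal ((if y 0 = x then (1 : ℝ) else 0) *
          ∏ i : Fin n, heatKer K (t i.succ - t i.castSucc) (y i.castSucc) (y i.succ))

namespace CTMC

variable {V : Type} [Fintype V] [DecidableEq V] {K : Matrix V V ℝ}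

/-- Hitting time of a set of states. -/
def hit (W : CTMC V K) (A : Set V) (ω : W.Ω) : ℝ :=
  sInf {t : ℝ | 0 ≤ t ∧ W.X t ω ∈ A}

/-- Cover time: the first time every state has been visited. -/
def cov (W : CTMC V K) (ω : W.Ω) : ℝ :=
  sInf {t : ℝ | 0 ≤ t ∧ ∀ y : V, ∃ s, 0 ≤ s ∧ s ≤ t ∧ W.X s ω = y}

/-- The uncovered set at time `t`. -/
def uncov (W : CTMC V K) (t : ℝ) (ω : W.Ω) : Set V :=
  {y | ∀ s, 0 ≤ s → s ≤ t → W.X s ω ≠ y}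

/-- Local time at `y` up to time `t`. -/
def loc (W : CTMC V K) (y : V) (t : ℝ) (ω : W.Ω) : ℝ :=
  ∫ s in (0:ℝ)..t, (if W.X s ω = y then (1 : ℝ) else 0)

/-- Probability of an event for the walk started at `x`. -/
def prx (W : CTMC V K) (x : V) (S : Set W.Ω) : ℝ := (W.P x S).toReal

/-- Expectation of a path functional for the walk started at `x`. -/
def ex (W : CTMC V K) (x : V) (f : W.Ω → ℝ) : ℝ := ∫ ω, f ω ∂(W.P x)

/-- Probability of an event for the walk started from the uniform (stationary) distribution. -/
def prpi (W : CTMC V K) (S : Set W.Ω) : ℝ :=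
  (Fintype.card V : ℝ)⁻¹ * ∑ x : V, W.prx x S

/-- Expectation for the walk started from the uniform (stationary) distribution. -/
def epi (W : CTMC V K) (f : W.Ω → ℝ) : ℝ :=
  (Fintype.card V : ℝ)⁻¹ * ∑ x : V, W.ex x f

/-- Probability for the walk started from the initial distribution `a`. -/
def prw (W : CTMC V K) (a : V → ℝ) (S : Set W.Ω) : ℝ := ∑ x : V, a x * W.prx x S

/-- Expectation for the walk started from the initial distribution `a`. -/
def exw (W : CTMC V K) (a : V → ℝ) (f : W.Ω → ℝ) : ℝ := ∑ x : V, a x * W.ex x f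

end CTMC

/-- Total variation mixing time at level `1/4`. -/
def tmixTV {V : Type} [Fintype V] [DecidableEq V] (K : Matrix V V ℝ) : ℝ :=
  sInf {t : ℝ | 0 ≤ t ∧ ∀ x : V, ∑ y : V, |heatKer K t x y - (Fintype.card V : ℝ)⁻¹| ≤ 1 / 2}

/-- Transition matrix of the simple random walk on a graph. -/
def transMat {V : Type} [Fintype V] [DecidableEq V] (G : SimpleGraph V) [DecidableRel G.Adj] :
    Matrix V V ℝ :=
  Matrix.of fun x y => if G.Adj x y then ((G.degree x : ℝ))⁻¹ else 0

/-- Diameter of a finite graph. -/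
def gDiam {V : Type} [Fintype V] (G : SimpleGraph V) : ℕ :=
  Finset.univ.sup fun p : V × V => G.dist p.1 p.2

/-- Vertex-transitivity of a graph. -/
def IsVertexTransitive {V : Type} (G : SimpleGraph V) : Prop :=
  ∀ x y : V, ∃ φ : SimpleGraph.Iso G G, φ x = y

/-- A finite graph bundled together with a continuous-time rate-1 simple random walk on it. -/
structure GW where
  (V : Type) [fin : Fintype V] [deq : DecidableEq V]
  (G : SimpleGraph V) [adj : DecidableRel G.Adj]
  (W : CTMC V (transMat G))

instance (B : GW) : Fintype B.V := B.fin
instance (B : GW) : DecidableEq B.V := B.deq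
instance (B : GW) : DecidableRel B.G.Adj := B.adj
instance (B : GW) : MeasurableSpace B.W.Ω := B.W.mΩ

/-- Number of vertices. -/
def GW.nV (B : GW) : ℕ := Fintype.card B.V

/-- Diameter. -/
def GW.D (B : GW) : ℕ := gDiam B.G

/-- `f(n)`, defined by `n = D² f(n)`. -/
def GW.fgrowth (B : GW) : ℝ := (B.nV : ℝ) / (B.D : ℝ) ^ 2

/-- Standing assumptions: a sequence of finite connected vertex-transitive graphs with
degrees uniformly bounded by `d`, of diverging sizes, satisfying the diameter condition
`D² = o(n / log n)`. -/
def GoodSeq (B : ℕ → GW) (d : ℕ) : Prop :=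
  (∀ n, (B n).G.Connected) ∧
  (∀ n, IsVertexTransitive (B n).G) ∧
  (∀ n (x : (B n).V), (B n).G.degree x ≤ d) ∧
  Tendsto (fun n => (B n).nV) atTop atTop ∧
  Tendsto (fun n => ((B n).D : ℝ) ^ 2 * Real.log ((B n).nV) / ((B n).nV)) atTop (nhds 0)

/-- The transition matrix of the chain killed upon hitting `A`. -/
def killedMat {V : Type} [Fintype V] [DecidableEq V] (K : Matrix V V ℝ) (A : Finset V) :
    Matrix V V ℝ :=
  Matrix.of fun x y => if x ∈ A ∨ y ∈ A then 0 else K x y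

/-- `a` is the quasi-stationary distribution of `A` with rate `lam`: a probability
distribution supported off `A` which is a left eigenvector of the killed matrix for the
eigenvalue `1 - lam`, where `lam` is the smallest eigenvalue of `I_B - P_B`. -/
structure IsQSD {V : Type} [Fintype V] [DecidableEq V] (K : Matrix V V ℝ) (A : Finset V)
    (a : V → ℝ) (lam : ℝ) : Prop where
  nonneg : ∀ x, 0 ≤ a x
  sum_one : ∑ x : V, a x = 1
  supported : ∀ v ∈ A, a v = 0
  eigen : ∀ y : V, ∑ x : V, a x * killedMat K A x y = (1 - lam) * a y
  minimal : ∀ (mu : ℝ) (g : V → ℝ), g ≠ 0 → (∀ v ∈ A, g v = 0) →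
    (∀ y : V, ∑ x : V, g x * killedMat K A x y = (1 - mu) * g y) → lam ≤ mu

/-- Spectral gap `1 - λ₂` of a reversible transition matrix `K` with stationary
distribution `pd`. -/
def specGap {V : Type} [Fintype V] (K : Matrix V V ℝ) (pd : V → ℝ) : ℝ :=
  sInf {r : ℝ | ∃ g : V → ℝ, g ≠ 0 ∧ (∑ x : V, pd x * g x = 0) ∧
    ∀ y : V, ∑ x : V, K y x * g x = (1 - r) * g y}

/-- Relaxation time of a reversible chain. -/
def trel {V : Type} [Fintype V] (K : Matrix V V ℝ) (pd : V → ℝ) : ℝ := (specGap K pd)⁻¹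

/-- Total variation distance between two Borel measures on `ℝ`. -/
def dTVReal (μ ν : Measure ℝ) : ℝ :=
  ⨆ A : {A : Set ℝ // MeasurableSet A}, |(μ A.1).toReal - (ν A.1).toReal|

/-- The standard Gumbel distribution on `ℝ` (distribution function `s ↦ exp (-e^{-s})`). -/
def gumbelMeasure : Measure ℝ :=
  volume.withDensity fun s => ENNReal.ofReal (Real.exp (-s - Real.exp (-s)))

/-- `ψ(u) = (2/π²) ∑_{k ≥ 1} cos(2πku)/k²`. -/
def psiSeries (u : ℝ) : ℝ :=
  (2 / Real.pi ^ 2) * ∑' k : ℕ, Real.cos (2 * Real.pi * ((k : ℝ) + 1) * u) / ((k : ℝ) + 1) ^ 2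

/-- The cycle graph on `ℤ/mℤ`. -/
def cycleG (m : ℕ) : SimpleGraph (ZMod m) := SimpleGraph.fromRel fun x y => x - y = 1

instance (m : ℕ) : DecidableRel (cycleG m).Adj := fun _ _ => Classical.dec _

section Poincare

open Finset Matrix

/-- The Dirichlet form of a symmetric stochastic matrix as a sum of squared differences. -/
lemma sum_sum_mul_sq_sub {V : Type} [Fintype V] {K : Matrix V V ℝ}
    (hsym : ∀ x y, K x y = K y x) (hrow : ∀ x, ∑ y, K x y = 1) (f : V → ℝ) :
    ∑ x, ∑ y, K x y * (f x - f y) ^ 2 = 2 * ∑ x, f x * (f x - (K *ᵥ f) x) := by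
  have h1 : ∑ x, ∑ y, K x y * f x ^ 2 = ∑ x, f x ^ 2 := by
    simp_rw [← sum_mul, hrow, one_mul]
  have h2 : ∑ x, ∑ y, K x y * f y ^ 2 = ∑ x, f x ^ 2 := by
    rw [sum_comm]
    simp_rw [fun y x => hsym x y]
    exact h1
  have h3 : ∑ x, ∑ y, K x y * (f x * f y) = ∑ x, f x * (K *ᵥ f) x := by
    simp only [mulVec, dotProduct, mul_sum]
    exact sum_congr rfl fun x _ => sum_congr rfl fun y _ => by ring
  calc ∑ x, ∑ y, K x y * (f x - f y) ^ 2
      = ∑ x, ∑ y, (K x y * f x ^ 2 + K x y * f y ^ 2 - 2 * (K x y * (f x * f y))) :=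
        sum_congr rfl fun x _ => sum_congr rfl fun y _ => by ring
    _ = ∑ x, f x ^ 2 + ∑ x, f x ^ 2 - 2 * ∑ x, f x * (K *ᵥ f) x := by
        simp only [sum_sub_distrib, sum_add_distrib, ← mul_sum, h1, h2, h3]
    _ = 2 * ∑ x, f x * (f x - (K *ᵥ f) x) := by
        simp only [mul_sub, sum_sub_distrib, ← pow_two]
        ring

lemma sum_sum_sq_sub {V : Type} [Fintype V] (f : V → ℝ) :
    ∑ x, ∑ y, (f x - f y) ^ 2 = 2 * (Fintype.card V * ∑ x, f x ^ 2 - (∑ x, f x) ^ 2) := by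
  have h (x y : V) : (f x - f y) ^ 2 = f x ^ 2 + f y ^ 2 - 2 * (f x * f y) := by ring
  simp only [h, sum_sub_distrib, sum_add_distrib, ← mul_sum, sum_const, ← sum_mul, card_univ,
    nsmul_eq_mul]
  ring

variable {V : Type} [Fintype V] {G : SimpleGraph V}

/-- The squared local gradient of `f` at `x`. -/
def localGrad (G : SimpleGraph V) [DecidableRel G.Adj] (f : V → ℝ) (x : V) : ℝ :=
  ∑ y, if G.Adj x y then (f x - f y) ^ 2 else 0

lemma card_mul_sum_aut_comp [Fintype (G ≃g G)] (hG : IsVertexTransitive G)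
    (g : V → ℝ) (x : V) :
    Fintype.card V * ∑ φ : G ≃g G, g (φ x) = Fintype.card (G ≃g G) * ∑ y, g y := by
  have hconst (y : V) : ∑ φ : G ≃g G, g (φ y) = ∑ φ : G ≃g G, g (φ x) := by
    obtain ⟨ψ, rfl⟩ := hG x y
    exact Fintype.sum_equiv
      ⟨fun φ => ψ.trans φ, fun φ => ψ.symm.trans φ, fun φ => by ext; simp, fun φ => by ext; simp⟩
      _ _ fun φ => rfl
  calc (Fintype.card V : ℝ) * ∑ φ : G ≃g G, g (φ x)
      = ∑ y, ∑ φ : G ≃g G, g (φ y) := by simp [hconst]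
    _ = ∑ φ : G ≃g G, ∑ y, g (φ y) := sum_comm
    _ = ∑ φ : G ≃g G, ∑ y, g y :=
        sum_congr rfl fun φ _ => Fintype.sum_equiv φ.toEquiv _ _ fun y => rfl
    _ = _ := by simp

lemma sum_aut_sq_sub_le [Fintype (G ≃g G)] [DecidableRel G.Adj] (hG : IsVertexTransitive G)
    (f : V → ℝ) {x y : V} (p : G.Walk x y) :
    Fintype.card V * ∑ φ : G ≃g G, (f (φ x) - f (φ y)) ^ 2 ≤
      (p.length : ℝ) ^ 2 * (Fintype.card (G ≃g G) * ∑ v, localGrad G f v) := by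
  have hgrad (v : V) : 0 ≤ localGrad G f v :=
    sum_nonneg fun w _ => by split_ifs <;> positivity
  have hS : 0 ≤ Fintype.card (G ≃g G) * ∑ v, localGrad G f v :=
    mul_nonneg (by positivity) (sum_nonneg fun v _ => hgrad v)
  induction p with
  | nil => simp
  | @cons u v w h p ih =>
    have hstep : Fintype.card V * ∑ φ : G ≃g G, (f (φ u) - f (φ v)) ^ 2 ≤
        Fintype.card (G ≃g G) * ∑ v, localGrad G f v := by
      rw [← card_mul_sum_aut_comp hG (localGrad G f) u]
      gcongr with φ
      have := single_le_sum
        (f := fun y => if G.Adj (φ u) y then (f (φ u) - f y) ^ 2 else 0)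
        (fun y _ => by split_ifs <;> positivity) (mem_univ (φ v))
      rw [if_pos (φ.map_adj_iff.2 h)] at this
      exact this
    rcases Nat.eq_zero_or_pos p.length with h0 | h0
    · have := SimpleGraph.Walk.eq_of_length_eq_zero h0
      subst this
      simpa [h0] using hstep
    · set l : ℝ := (p.length : ℝ)
      have hl0 : 0 < l := Nat.cast_pos.2 h0
      have hpt (a b : ℝ) : l * (a + b) ^ 2 ≤ l * (l + 1) * a ^ 2 + (l + 1) * b ^ 2 := by
        nlinarith [sq_nonneg (l * a - b)]
      have hsum : l * ∑ φ : G ≃g G, (f (φ u) - f (φ w)) ^ 2 ≤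
          l * (l + 1) * ∑ φ : G ≃g G, (f (φ u) - f (φ v)) ^ 2 +
            (l + 1) * ∑ φ : G ≃g G, (f (φ v) - f (φ w)) ^ 2 := by
        simp only [mul_sum, ← sum_add_distrib]
        refine sum_le_sum fun φ _ => ?_
        have := hpt (f (φ u) - f (φ v)) (f (φ v) - f (φ w))
        rwa [sub_add_sub_cancel] at this
      rw [SimpleGraph.Walk.length_cons]
      push_cast
      refine le_of_mul_le_mul_left ?_ hl0
      have h1 := mul_le_mul_of_nonneg_left hsum (Nat.cast_nonneg (α := ℝ) (Fintype.card V))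
      have h2 := mul_le_mul_of_nonneg_left hstep (by positivity : 0 ≤ l * (l + 1))
      have h3 := mul_le_mul_of_nonneg_left ih (by positivity : 0 ≤ l + 1)
      linarith

lemma sum_localGrad [DecidableEq V] [DecidableRel G.Adj] {r : ℕ}
    (hr : ∀ x, G.degree x = r) (hr0 : 0 < r) (f : V → ℝ) :
    ∑ x, localGrad G f x = r * ∑ x, ∑ y, transMat G x y * (f x - f y) ^ 2 := by
  have : (r : ℝ) ≠ 0 := by positivity
  simp only [localGrad, transMat, of_apply, mul_sum, hr]
  refine sum_congr rfl fun x _ => sum_congr rfl fun y _ => ?_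
  split_ifs
  · field_simp
  · simp

/-- Poincaré inequality for the simple random walk on a vertex-transitive graph. -/
lemma poincare_of_isVertexTransitive [DecidableEq V] [DecidableRel G.Adj] (hc : G.Connected)
    (hG : IsVertexTransitive G) {r : ℕ} (hr : ∀ x, G.degree x = r) (hr0 : 0 < r) (f : V → ℝ) :
    ∑ x, ∑ y, (f x - f y) ^ 2 ≤ r * (gDiam G : ℝ) ^ 2 * Fintype.card V *
      ∑ x, ∑ y, transMat G x y * (f x - f y) ^ 2 := by
  have : Finite (G ≃g G) := DFunLike.finite _
  have : Fintype (G ≃g G) := Fintype.ofFinite _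
  have := hc.nonempty
  set a : ℝ := (Fintype.card (G ≃g G) : ℝ)
  set n : ℝ := (Fintype.card V : ℝ)
  set E := ∑ x, ∑ y, transMat G x y * (f x - f y) ^ 2
  have ha : 0 < a := by
    have : Nonempty (G ≃g G) := ⟨RelIso.refl _⟩
    exact Nat.cast_pos.2 Fintype.card_pos
  have hn : 0 < n := Nat.cast_pos.2 Fintype.card_pos
  have hE : 0 ≤ E := sum_nonneg fun x _ => sum_nonneg fun y _ => by
    simp only [transMat, of_apply]
    split_ifs <;> positivity
  have hpair (x y : V) :
      n * ∑ φ : G ≃g G, (f (φ x) - f (φ y)) ^ 2 ≤ (gDiam G : ℝ) ^ 2 * (a * (r * E)) := by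
    obtain ⟨p, hp⟩ := hc.exists_walk_length_eq_dist x y
    have h := sum_aut_sq_sub_le hG f p
    rw [sum_localGrad hr hr0] at h
    refine h.trans ?_
    have : p.length ≤ gDiam G := by
      rw [hp]
      exact le_sup (f := fun p : V × V => G.dist p.1 p.2) (mem_univ (x, y))
    gcongr
  have hswap : ∑ x, ∑ y, ∑ φ : G ≃g G, (f (φ x) - f (φ y)) ^ 2 =
      a * ∑ x, ∑ y, (f x - f y) ^ 2 := by
    calc _ = ∑ φ : G ≃g G, ∑ x, ∑ y, (f (φ x) - f (φ y)) ^ 2 := by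
          rw [sum_comm]
          simp_rw [sum_comm (s := (univ : Finset V)) (t := (univ : Finset (G ≃g G)))]
          refine sum_congr rfl fun φ _ => ?_
          rw [sum_comm]
      _ = ∑ φ : G ≃g G, ∑ x, ∑ y, (f x - f y) ^ 2 := by
          refine sum_congr rfl fun φ _ => ?_
          refine Fintype.sum_equiv φ.toEquiv _ _ fun x => ?_
          exact Fintype.sum_equiv φ.toEquiv _ _ fun y => rfl
      _ = _ := by simp [a]
  have htot : n * (a * ∑ x, ∑ y, (f x - f y) ^ 2) ≤
      n * n * ((gDiam G : ℝ) ^ 2 * (a * (r * E))) := by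
    rw [← hswap, mul_sum]
    simp_rw [mul_sum (s := (univ : Finset V))]
    refine (sum_le_sum fun x _ => sum_le_sum fun y _ => hpair x y).trans ?_
    simp [n, mul_assoc]
  refine le_of_mul_le_mul_left ?_ (mul_pos hn ha)
  calc _ = n * (a * ∑ x, ∑ y, (f x - f y) ^ 2) := by ring
    _ ≤ _ := htot
    _ = _ := by ring

end Poincare

section QuasiStationary

open Finset Matrix

variable {V : Type} [Fintype V] {K : Matrix V V ℝ}

/-- `g` vanishes as soon as it vanishes at a point and its Dirichlet form is nonpositive. -/
lemma eq_zero_of_dirichlet_nonpos {τ : ℝ} (hτ : 0 ≤ τ)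
    (hP : ∀ f : V → ℝ, ∑ x, ∑ y, (f x - f y) ^ 2 ≤
      τ * ∑ x, f x * (f x - (K *ᵥ f) x))
    {g : V → ℝ} {a : V} (ha : g a = 0) (hg : ∑ x, g x * (g x - (K *ᵥ g) x) ≤ 0) : g = 0 := by
  have h0 : ∑ x, ∑ y, (g x - g y) ^ 2 ≤ 0 :=
    (hP g).trans (mul_nonpos_of_nonneg_of_nonpos hτ hg)
  funext x
  have h1 : (g x - g a) ^ 2 ≤ ∑ y, (g x - g y) ^ 2 :=
    single_le_sum (f := fun y => (g x - g y) ^ 2) (fun y _ => sq_nonneg _) (mem_univ a)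
  have h2 : ∑ y, (g x - g y) ^ 2 ≤ ∑ x, ∑ y, (g x - g y) ^ 2 :=
    single_le_sum (f := fun x => ∑ y, (g x - g y) ^ 2)
      (fun x _ => sum_nonneg fun y _ => sq_nonneg _) (mem_univ x)
  have h3 : (g x - g a) ^ 2 = 0 := le_antisymm (h1.trans (h2.trans h0)) (sq_nonneg _)
  simpa [ha] using h3

lemma sum_mul_sub_mulVec_comm (hsym : ∀ x y, K x y = K y x) (f g : V → ℝ) :
    ∑ x, f x * (g x - (K *ᵥ g) x) = ∑ x, g x * (f x - (K *ᵥ f) x) := by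
  have h : ∑ x, f x * (K *ᵥ g) x = ∑ x, g x * (K *ᵥ f) x := by
    simp only [mulVec, dotProduct, mul_sum]
    rw [sum_comm]
    refine sum_congr rfl fun x _ => sum_congr rfl fun y _ => ?_
    rw [hsym y x]
    ring
  simp only [mul_sub, sum_sub_distrib, h]
  congr 1
  exact sum_congr rfl fun x _ => mul_comm _ _

variable [DecidableEq V] {A : Finset V}

/-- The Dirichlet problem for the expected hitting time of `A` has a solution. -/
lemma exists_expected_hitting {τ : ℝ} (hτ : 0 ≤ τ)
    (hP : ∀ f : V → ℝ, ∑ x, ∑ y, (f x - f y) ^ 2 ≤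
      τ * ∑ x, f x * (f x - (K *ᵥ f) x)) (hA : A.Nonempty) :
    ∃ h : V → ℝ, (∀ x ∈ A, h x = 0) ∧ ∀ x ∉ A, h x - (K *ᵥ h) x = 1 := by
  let L : (V → ℝ) →ₗ[ℝ] (V → ℝ) :=
    { toFun := fun g x => if x ∈ A then g x else g x - (K *ᵥ g) x
      map_add' := fun g g' => by
        funext x
        by_cases hx : x ∈ A
        · simp [hx]
        · simp [hx, mulVec_add]
          ring
      map_smul' := fun c g => by
        funext x
        by_cases hx : x ∈ A
        · simp [hx]
        · simp [hx, mulVec_smul]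
          ring }
  have hL (g : V → ℝ) (x : V) : L g x = if x ∈ A then g x else g x - (K *ᵥ g) x := rfl
  obtain ⟨a, ha⟩ := hA
  have hinj : Function.Injective L := by
    rw [← LinearMap.ker_eq_bot, LinearMap.ker_eq_bot']
    intro g hg
    have hgx (x : V) := (hL g x).symm.trans (congrFun hg x)
    refine eq_zero_of_dirichlet_nonpos hτ hP (a := a) (by simpa [ha] using hgx a) ?_
    refine (sum_eq_zero fun x _ => ?_).le
    by_cases hx : x ∈ A
    · have : g x = 0 := by simpa [hx] using hgx x
      simp [this]
    · have : g x - (K *ᵥ g) x = 0 := by simpa [hx] using hgx x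
      simp [this]
  obtain ⟨h, hh⟩ := LinearMap.injective_iff_surjective.1 hinj fun x => if x ∈ A then 0 else 1
  have hhx (x : V) := (hL h x).symm.trans (congrFun hh x)
  refine ⟨h, fun x hx => by simpa [hx] using hhx x, fun x hx => by simpa [hx] using hhx x⟩

lemma expected_hitting_nonneg (hnn : ∀ x y, 0 ≤ K x y) (hrow : ∀ x, ∑ y, K x y = 1) {h : V → ℝ}
    (h0 : ∀ x ∈ A, h x = 0) (h1 : ∀ x ∉ A, h x - (K *ᵥ h) x = 1) (x : V) : 0 ≤ h x := by
  have : Nonempty V := ⟨x⟩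
  obtain ⟨m, hm⟩ := Finite.exists_min h
  refine le_trans ?_ (hm x)
  by_cases hmA : m ∈ A
  · exact (h0 m hmA).ge
  · have h2 : h m ≤ (K *ᵥ h) m := by
      calc h m = ∑ y, K m y * h m := by rw [← sum_mul, hrow, one_mul]
        _ ≤ ∑ y, K m y * h y := sum_le_sum fun y _ => mul_le_mul_of_nonneg_left (hm y) (hnn m y)
        _ = (K *ᵥ h) m := rfl
    linarith [h1 m hmA]

lemma sum_mul_killedMat (hsym : ∀ x y, K x y = K y x) {g : V → ℝ} (hg : ∀ x ∈ A, g x = 0)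
    {y : V} (hy : y ∉ A) : ∑ x, g x * killedMat K A x y = (K *ᵥ g) y := by
  simp only [mulVec, dotProduct]
  refine sum_congr rfl fun x _ => ?_
  by_cases hx : x ∈ A
  · simp [hg x hx]
  · simp [killedMat, hx, hy, hsym x y, mul_comm]

/-- Rayleigh bound for the killed walk. -/
lemma IsQSD.mul_sum_sq_le (hsym : ∀ x y, K x y = K y x) {a : V → ℝ} {lam : ℝ}
    (hq : IsQSD K A a lam) {g : V → ℝ} (hg : ∀ x ∈ A, g x = 0) :
    lam * ∑ x, g x ^ 2 ≤ ∑ x, g x * (g x - (K *ᵥ g) x) := by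
  let R : Matrix V V ℝ := diagonal (fun x => if x ∈ A then 1 else 1 - lam) - killedMat K A
  have hR : R.IsHermitian := by
    ext x y
    have h1 : killedMat K A y x = killedMat K A x y := by
      simp [killedMat, hsym y x, or_comm]
    by_cases hxy : x = y
    · simp [R, hxy]
    · simp [R, h1, diagonal_apply_ne _ hxy, diagonal_apply_ne _ (Ne.symm hxy)]
  have hRv (v : V → ℝ) (y : V) : (R *ᵥ v) y =
      (if y ∈ A then 1 else 1 - lam) * v y - ∑ x, v x * killedMat K A x y := by
    simp only [R, sub_mulVec, Pi.sub_apply, mulVec_diagonal]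
    congr 1
    simp only [mulVec, dotProduct]
    refine sum_congr rfl fun x _ => ?_
    simp [killedMat, hsym y x, or_comm, mul_comm]
  have hkA (v : V → ℝ) {y : V} (hy : y ∈ A) : ∑ x, v x * killedMat K A x y = 0 :=
    sum_eq_zero fun x _ => by simp [killedMat, hy]
  have hpos : R.PosSemidef := by
    rw [hR.posSemidef_iff_eigenvalues_nonneg]
    intro i
    set r := hR.eigenvalues i
    set v : V → ℝ := (hR.eigenvectorBasis i).ofLp
    have hv : R *ᵥ v = r • v := hR.mulVec_eigenvectorBasis i
    have hv0 : v ≠ 0 := fun h => hR.eigenvectorBasis.toBasis.ne_zero i (by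
      ext x
      exact congrFun h x)
    have hvy (y : V) := (hRv v y).symm.trans (congrFun hv y)
    simp only [Pi.smul_apply, smul_eq_mul] at hvy
    change 0 ≤ r
    by_cases hvA : ∀ y ∈ A, v y = 0
    · have := hq.minimal (lam + r) v hv0 hvA fun y => by
        by_cases hy : y ∈ A
        · simp [hkA v hy, hvA y hy]
        · have := hvy y
          simp only [hy, if_false] at this
          linarith
      linarith
    · push Not at hvA
      obtain ⟨y, hy, hy0⟩ := hvA
      have := hvy y
      simp only [hy, if_true, hkA v hy, one_mul, sub_zero] at this
      have : r = 1 := mul_right_cancel₀ hy0 (by linarith)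
      linarith
  have h := hpos.dotProduct_mulVec_nonneg g
  have h2 : star g ⬝ᵥ (R *ᵥ g) =
      ∑ x, g x * (g x - (K *ᵥ g) x) - lam * ∑ x, g x ^ 2 := by
    simp only [dotProduct, hRv, star_trivial, mul_sum, ← sum_sub_distrib]
    refine sum_congr rfl fun y _ => ?_
    by_cases hy : y ∈ A
    · simp [hg y hy]
    · simp only [hy, if_false, sum_mul_killedMat hsym hg hy]
      ring
  linarith

lemma IsQSD.sub_mulVec (hsym : ∀ x y, K x y = K y x) {a : V → ℝ} {lam : ℝ}
    (hq : IsQSD K A a lam) {y : V} (hy : y ∉ A) : a y - (K *ᵥ a) y = lam * a y := by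
  have := hq.eigen y
  rw [sum_mul_killedMat hsym hq.supported hy] at this
  linarith

lemma IsQSD.sum_mul_sub_mulVec (hsym : ∀ x y, K x y = K y x) {a : V → ℝ} {lam : ℝ}
    (hq : IsQSD K A a lam) {g : V → ℝ} (hg : ∀ x ∈ A, g x = 0) :
    ∑ x, a x * (g x - (K *ᵥ g) x) = lam * ∑ x, a x * g x := by
  rw [sum_mul_sub_mulVec_comm hsym, mul_sum]
  refine sum_congr rfl fun x _ => ?_
  by_cases hx : x ∈ A
  · simp [hg x hx]
  · rw [hq.sub_mulVec hsym hx]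
    ring

lemma IsQSD.rate_pos (hsym : ∀ x y, K x y = K y x) {τ : ℝ} (hτ : 0 ≤ τ)
    (hP : ∀ f : V → ℝ, ∑ x, ∑ y, (f x - f y) ^ 2 ≤
      τ * ∑ x, f x * (f x - (K *ᵥ f) x)) (hA : A.Nonempty) {a : V → ℝ} {lam : ℝ}
    (hq : IsQSD K A a lam) : 0 < lam := by
  by_contra! hlam
  obtain ⟨v, hv⟩ := hA
  have h0 : a = 0 := by
    refine eq_zero_of_dirichlet_nonpos hτ hP (hq.supported v hv) ?_
    rw [hq.sum_mul_sub_mulVec hsym hq.supported]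
    exact mul_nonpos_of_nonpos_of_nonneg hlam
      (sum_nonneg fun x _ => mul_nonneg (hq.nonneg x) (hq.nonneg x))
  have := hq.sum_one
  simp [h0] at this

/-- The mean of the hitting time under the quasi-stationary distribution. -/
lemma IsQSD.mul_sum_mul_expected_hitting (hsym : ∀ x y, K x y = K y x) {a : V → ℝ} {lam : ℝ}
    (hq : IsQSD K A a lam) {h : V → ℝ} (h0 : ∀ x ∈ A, h x = 0)
    (h1 : ∀ x ∉ A, h x - (K *ᵥ h) x = 1) : lam * ∑ x, a x * h x = 1 := by
  rw [← hq.sum_mul_sub_mulVec hsym h0, ← hq.sum_one]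
  refine sum_congr rfl fun x _ => ?_
  by_cases hx : x ∈ A
  · simp [hq.supported x hx]
  · rw [h1 x hx, mul_one]

lemma sum_expected_hitting_eq {h : V → ℝ} (h0 : ∀ x ∈ A, h x = 0)
    (h1 : ∀ x ∉ A, h x - (K *ᵥ h) x = 1) : ∑ x, h x * (h x - (K *ᵥ h) x) = ∑ x, h x := by
  refine sum_congr rfl fun x _ => ?_
  by_cases hx : x ∈ A
  · simp [h0 x hx]
  · rw [h1 x hx, mul_one]

lemma IsQSD.mul_sum_expected_hitting_le (hsym : ∀ x y, K x y = K y x)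
    {a : V → ℝ} {lam : ℝ} (hlam : 0 < lam) (hq : IsQSD K A a lam) {h : V → ℝ}
    (hh : ∀ x, 0 ≤ h x) (h0 : ∀ x ∈ A, h x = 0) (h1 : ∀ x ∉ A, h x - (K *ᵥ h) x = 1) :
    lam * ∑ x, h x ≤ Fintype.card V := by
  have hray := hq.mul_sum_sq_le hsym h0
  rw [sum_expected_hitting_eq h0 h1] at hray
  have hcs : (∑ x, h x) ^ 2 ≤ Fintype.card V * ∑ x, h x ^ 2 := by
    simpa using sq_sum_le_card_mul_sum_sq (s := univ) (f := h)
  have hS : 0 ≤ ∑ x, h x := sum_nonneg fun x _ => hh x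
  rcases hS.eq_or_lt with hS | hS
  · simp [← hS]
  · refine le_of_mul_le_mul_right ?_ hS
    have h2 := mul_le_mul_of_nonneg_left hcs hlam.le
    have h3 := mul_le_mul_of_nonneg_left hray (Nat.cast_nonneg (α := ℝ) (Fintype.card V))
    nlinarith

lemma IsQSD.one_le_sum_expected_hitting (hsym : ∀ x y, K x y = K y x)
    (hnn : ∀ x y, 0 ≤ K x y) (hrow : ∀ x, ∑ y, K x y = 1)
    {a : V → ℝ} {lam : ℝ} (hq : IsQSD K A a lam) {h : V → ℝ}
    (h0 : ∀ x ∈ A, h x = 0) (h1 : ∀ x ∉ A, h x - (K *ᵥ h) x = 1) :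
    1 ≤ lam * (∑ x, a x ^ 2) * ∑ x, h x := by
  have hnonneg (t : ℝ) :
      0 ≤ (lam * ∑ x, a x ^ 2) * (t * t) + (-2) * t + ∑ x, h x := by
    set g : V → ℝ := t • a - h with hg
    have hD : 0 ≤ ∑ x, g x * (g x - (K *ᵥ g) x) := by
      have := sum_sum_mul_sq_sub hsym hrow g
      have h2 : 0 ≤ ∑ x, ∑ y, K x y * (g x - g y) ^ 2 :=
        sum_nonneg fun x _ => sum_nonneg fun y _ => mul_nonneg (hnn x y) (sq_nonneg _)
      linarith
    have hah : ∑ x, a x * (h x - (K *ᵥ h) x) = 1 := by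
      rw [hq.sum_mul_sub_mulVec hsym h0, hq.mul_sum_mul_expected_hitting hsym h0 h1]
    have hha : ∑ x, h x * (a x - (K *ᵥ a) x) = 1 := by
      rw [sum_mul_sub_mulVec_comm hsym, hah]
    have haa : ∑ x, a x * (a x - (K *ᵥ a) x) = lam * ∑ x, a x ^ 2 := by
      rw [hq.sum_mul_sub_mulVec hsym hq.supported]
      simp only [pow_two]
    have hexp : ∑ x, g x * (g x - (K *ᵥ g) x) =
        t * t * ∑ x, a x * (a x - (K *ᵥ a) x) - t * ∑ x, a x * (h x - (K *ᵥ h) x) -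
          t * ∑ x, h x * (a x - (K *ᵥ a) x) + ∑ x, h x * (h x - (K *ᵥ h) x) := by
      simp only [mul_sum, ← sum_sub_distrib, ← sum_add_distrib, hg, mulVec_sub, mulVec_smul,
        Pi.sub_apply, Pi.smul_apply, smul_eq_mul]
      exact sum_congr rfl fun x _ => by ring
    rw [hexp, hah, hha, haa, sum_expected_hitting_eq h0 h1] at hD
    linarith
  have := discrim_le_zero hnonneg
  rw [discrim] at this
  linarith

/-- The stationary and quasi-stationary mean hitting times differ by at most the
Poincaré constant. -/
lemma IsQSD.abs_expected_hitting_sub_le (hsym : ∀ x y, K x y = K y x)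
    (hnn : ∀ x y, 0 ≤ K x y) (hrow : ∀ x, ∑ y, K x y = 1) {τ : ℝ} (hτ : 0 ≤ τ)
    (hP : ∀ f : V → ℝ, ∑ x, ∑ y, (f x - f y) ^ 2 ≤
      2 * τ * Fintype.card V * ∑ x, f x * (f x - (K *ᵥ f) x)) (hA : A.Nonempty)
    {a : V → ℝ} {lam : ℝ} (hq : IsQSD K A a lam) {h : V → ℝ}
    (h0 : ∀ x ∈ A, h x = 0) (h1 : ∀ x ∉ A, h x - (K *ᵥ h) x = 1) :
    |(Fintype.card V : ℝ)⁻¹ * ∑ x, h x - ∑ x, a x * h x| ≤ τ := by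
  have hlam := hq.rate_pos hsym (by positivity) hP hA
  have : Nonempty V := ⟨hA.choose⟩
  have hn : 0 < (Fintype.card V : ℝ) := Nat.cast_pos.2 Fintype.card_pos
  set n : ℝ := (Fintype.card V : ℝ)
  have hh := expected_hitting_nonneg hnn hrow h0 h1
  have hup := hq.mul_sum_expected_hitting_le hsym hlam hh h0 h1
  have hlow := hq.one_le_sum_expected_hitting hsym hnn hrow h0 h1
  have hqh := hq.mul_sum_mul_expected_hitting hsym h0 h1
  have hPa := hP a
  rw [sum_sum_sq_sub, hq.sum_one, hq.sum_mul_sub_mulVec hsym hq.supported] at hPa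
  simp only [← pow_two] at hPa
  change 2 * (n * _ - _) ≤ _ at hPa
  set S := ∑ x, h x
  set T := ∑ x, a x * h x
  set Q := ∑ x, a x ^ 2
  have hS : 0 ≤ S := sum_nonneg fun x _ => hh x
  have hT : 0 ≤ T := sum_nonneg fun x _ => mul_nonneg (hq.nonneg x) (hh x)
  set m := n⁻¹ * S with hm
  have hSm : S = n * m := by rw [hm]; field_simp
  rw [hSm] at hup hlow
  have hm0 : 0 ≤ m := by positivity
  have hmT : m ≤ T := by
    refine le_of_mul_le_mul_left (le_of_mul_le_mul_left ?_ hn) hlam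
    calc n * (lam * m) = lam * (n * m) := by ring
      _ ≤ n := hup
      _ = n * (lam * T) := by rw [hqh, mul_one]
  rw [abs_sub_comm, abs_of_nonneg (by linarith)]
  by_cases hτl : 1 ≤ τ * lam
  · have : T ≤ τ := by
      refine le_of_mul_le_mul_left ?_ hlam
      linarith
    linarith
  · push Not at hτl
    have hQ : n * Q * (1 - τ * lam) ≤ 1 := by nlinarith
    have hkey : (1 - τ * lam) ≤ lam * m := by
      have h2 : 1 - τ * lam ≤ (lam * Q * (n * m)) * (1 - τ * lam) :=
        le_mul_of_one_le_left (by linarith) hlow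
      have h3 : (n * Q * (1 - τ * lam)) * (lam * m) ≤ 1 * (lam * m) :=
        mul_le_mul_of_nonneg_right hQ (by positivity)
      linarith
    refine le_of_mul_le_mul_left ?_ hlam
    linarith

lemma IsQSD.rate_le (hsym : ∀ x y, K x y = K y x)
    (hnn : ∀ x y, 0 ≤ K x y) (hrow : ∀ x, ∑ y, K x y = 1)
    {a : V → ℝ} {lam : ℝ} (hq : IsQSD K A a lam) :
    lam * (Fintype.card V - A.card) ≤ A.card := by
  set g : V → ℝ := fun x => if x ∈ A then 0 else 1
  have hgA : ∀ x ∈ A, g x = 0 := fun x hx => by simp [g, hx]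
  have hray := hq.mul_sum_sq_le hsym hgA
  have hcompl : ∑ x, g x = Fintype.card V - A.card := by
    have : ∑ x, g x = ∑ x, (1 - if x ∈ A then (1 : ℝ) else 0) :=
      sum_congr rfl fun x _ => by simp only [g]; split_ifs <;> norm_num
    rw [this, sum_sub_distrib]
    simp
  have hsq : ∑ x, g x ^ 2 = Fintype.card V - A.card := by
    rw [← hcompl]
    exact sum_congr rfl fun x _ => by simp only [g]; split_ifs <;> norm_num
  have hbound : ∑ x, g x * (g x - (K *ᵥ g) x) ≤ A.card := by
    calc ∑ x, g x * (g x - (K *ᵥ g) x)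
        ≤ ∑ x, ∑ y, K x y * (if y ∈ A then 1 else 0) := by
          refine sum_le_sum fun x _ => ?_
          have hx : ∑ y, K x y * (if y ∈ A then 1 else 0) = 1 - (K *ᵥ g) x := by
            conv_rhs => rw [← hrow x]
            simp only [mulVec, dotProduct, ← sum_sub_distrib]
            exact sum_congr rfl fun y _ => by simp only [g]; split_ifs <;> ring
          by_cases hxA : x ∈ A
          · simp only [hgA x hxA, zero_mul]
            exact sum_nonneg fun y _ => mul_nonneg (hnn x y) (by split_ifs <;> norm_num)
          · rw [hx]
            simp [g, hxA]
      _ = ∑ y, (∑ x, K y x) * (if y ∈ A then 1 else 0) := by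
          rw [sum_comm]
          simp_rw [sum_mul]
          exact sum_congr rfl fun y _ => sum_congr rfl fun x _ => by rw [hsym x y]
      _ = A.card := by simp [hrow]
  rw [hsq] at hray
  linarith

end QuasiStationary

section Skeleton

open Finset Matrix

variable {V : Type} [Fintype V] [DecidableEq V] {K : Matrix V V ℝ} {A : Finset V}

/-- The probability that a discrete-time chain with transition matrix `H` avoids `A` during its
first `N` steps. -/
def surv (H : V → V → ℝ) (A : Finset V) : ℕ → V → ℝ
  | 0, x => if x ∈ A then 0 else 1
  | N + 1, x => if x ∈ A then 0 else ∑ y, H x y * surv H A N y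

lemma surv_nonneg {H : V → V → ℝ} (hH : ∀ x y, 0 ≤ H x y) (N : ℕ) (x : V) :
    0 ≤ surv H A N x := by
  induction N generalizing x with
  | zero => simp only [surv]; split_ifs <;> norm_num
  | succ N ih =>
    simp only [surv]
    split_ifs
    · exact le_rfl
    · exact sum_nonneg fun y _ => mul_nonneg (hH x y) (ih y)

lemma surv_of_mem {H : V → V → ℝ} (N : ℕ) {x : V} (hx : x ∈ A) : surv H A N x = 0 := by
  cases N <;> simp [surv, hx]

lemma sum_range_succ_surv {H : V → V → ℝ} (N : ℕ) {x : V} (hx : x ∉ A) :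
    ∑ j ∈ range (N + 1), surv H A j x = 1 + ∑ y, H x y * ∑ j ∈ range N, surv H A j y := by
  rw [sum_range_succ', add_comm]
  simp only [surv, hx, if_false, mul_sum]
  rw [sum_comm]

lemma mul_sum_surv_le {H : V → V → ℝ} (hH : ∀ x y, 0 ≤ H x y) {h : V → ℝ} {c : ℝ}
    (hh : ∀ x, 0 ≤ h x) (h1 : ∀ x ∉ A, c ≤ h x - ∑ y, H x y * h y) (N : ℕ) (x : V) :
    c * ∑ j ∈ range N, surv H A j x ≤ h x := by
  induction N generalizing x with
  | zero => simpa using hh x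
  | succ N ih =>
    by_cases hx : x ∈ A
    · simpa [surv_of_mem _ hx] using hh x
    · have : ∑ y, H x y * (c * ∑ j ∈ range N, surv H A j y) ≤ ∑ y, H x y * h y :=
        sum_le_sum fun y _ => mul_le_mul_of_nonneg_left (ih y) (hH x y)
      rw [sum_range_succ_surv N hx, mul_add, mul_sum]
      simp_rw [mul_left_comm c]
      linarith [h1 x hx]

lemma le_add_mul_sum_surv {H : V → V → ℝ} (hH : ∀ x y, 0 ≤ H x y) {h : V → ℝ} {c M : ℝ}
    (hM : ∀ x, h x ≤ M) (h0 : ∀ x ∈ A, h x = 0)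
    (h1 : ∀ x ∉ A, h x - ∑ y, H x y * h y ≤ c) (N : ℕ) (x : V) :
    h x ≤ M * surv H A N x + c * ∑ j ∈ range N, surv H A j x := by
  induction N generalizing x with
  | zero =>
    by_cases hx : x ∈ A
    · simp [h0 x hx, surv_of_mem _ hx]
    · simpa [surv, hx] using hM x
  | succ N ih =>
    by_cases hx : x ∈ A
    · simp [h0 x hx, surv_of_mem _ hx]
    · have : ∑ y, H x y * h y ≤
          ∑ y, H x y * (M * surv H A N y + c * ∑ j ∈ range N, surv H A j y) :=
        sum_le_sum fun y _ => mul_le_mul_of_nonneg_left (ih y) (hH x y)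
      rw [sum_range_succ_surv N hx, mul_add, mul_sum]
      simp_rw [mul_left_comm c]
      simp only [mul_add, sum_add_distrib] at this
      simp only [surv, hx, if_false, mul_sum]
      simp_rw [mul_left_comm M]
      simp only [mul_sum] at this
      linarith [h1 x hx]

lemma summable_surv {H : V → V → ℝ} (hH : ∀ x y, 0 ≤ H x y) {h : V → ℝ} {c : ℝ} (hc : 0 < c)
    (hh : ∀ x, 0 ≤ h x) (h1 : ∀ x ∉ A, c ≤ h x - ∑ y, H x y * h y) (x : V) :
    Summable fun N => surv H A N x :=
  summable_of_sum_range_le (c := h x / c) (fun N => surv_nonneg hH N x) fun N => by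
    rw [le_div_iff₀' hc]
    exact mul_sum_surv_le hH hh h1 N x

lemma mul_tsum_surv_le {H : V → V → ℝ} (hH : ∀ x y, 0 ≤ H x y) {h : V → ℝ} {c : ℝ}
    (hc : 0 < c) (hh : ∀ x, 0 ≤ h x) (h1 : ∀ x ∉ A, c ≤ h x - ∑ y, H x y * h y) (x : V) :
    c * ∑' N, surv H A N x ≤ h x :=
  le_of_tendsto' ((summable_surv hH hc hh h1 x).hasSum.tendsto_sum_nat.const_mul c)
    fun N => mul_sum_surv_le hH hh h1 N x

lemma le_mul_tsum_surv {H : V → V → ℝ} (hH : ∀ x y, 0 ≤ H x y) {h : V → ℝ} {c M : ℝ}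
    (hM : ∀ x, h x ≤ M) (h0 : ∀ x ∈ A, h x = 0)
    (h1 : ∀ x ∉ A, h x - ∑ y, H x y * h y ≤ c) {x : V} (hs : Summable fun N => surv H A N x) :
    h x ≤ c * ∑' N, surv H A N x := by
  have := (hs.tendsto_atTop_zero.const_mul M).add (hs.hasSum.tendsto_sum_nat.const_mul c)
  rw [mul_zero, zero_add] at this
  exact ge_of_tendsto' this fun N => le_add_mul_sum_surv hH hM h0 h1 N x

section HeatKernel

lemma rowStochastic_pow (hnn : ∀ x y, 0 ≤ K x y) (hrow : ∀ x, ∑ y, K x y = 1) (k : ℕ) :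
    K ^ k ∈ rowStochastic ℝ V :=
  pow_mem (mem_rowStochastic_iff_sum.2 ⟨hnn, hrow⟩) k

lemma heatKer_nonneg (hnn : ∀ x y, 0 ≤ K x y) (hrow : ∀ x, ∑ y, K x y = 1) {t : ℝ} (ht : 0 ≤ t)
    (x y : V) : 0 ≤ heatKer K t x y :=
  tsum_nonneg fun k => mul_nonneg (by positivity)
    (nonneg_of_mem_rowStochastic (rowStochastic_pow hnn hrow k))

lemma abs_pow_mulVec_le (hnn : ∀ x y, 0 ≤ K x y) (hrow : ∀ x, ∑ y, K x y = 1) {h : V → ℝ} {M : ℝ}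
    (hM : ∀ x, |h x| ≤ M) (k : ℕ) (x : V) : |(K ^ k *ᵥ h) x| ≤ M := by
  have hk := rowStochastic_pow hnn hrow k
  calc |(K ^ k *ᵥ h) x| ≤ ∑ y, |(K ^ k) x y * h y| := abs_sum_le_sum_abs _ _
    _ ≤ ∑ y, (K ^ k) x y * M := sum_le_sum fun y _ => by
        rw [abs_mul, abs_of_nonneg (nonneg_of_mem_rowStochastic hk)]
        exact mul_le_mul_of_nonneg_left (hM y) (nonneg_of_mem_rowStochastic hk)
    _ = M := by rw [← sum_mul, sum_row_of_mem_rowStochastic hk, one_mul]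

lemma hasSum_heatKer_mul (hnn : ∀ x y, 0 ≤ K x y) (hrow : ∀ x, ∑ y, K x y = 1) {t : ℝ}
    (ht : 0 ≤ t) (h : V → ℝ) (x : V) :
    HasSum (fun k : ℕ => Real.exp (-t) * t ^ k / (Nat.factorial k : ℝ) * (K ^ k *ᵥ h) x)
      (∑ y, heatKer K t x y * h y) := by
  have hs (y : V) : Summable fun k : ℕ =>
      Real.exp (-t) * t ^ k / (Nat.factorial k : ℝ) * (K ^ k) x y := by
    refine Summable.of_nonneg_of_le (fun k => mul_nonneg (by positivity)
      (nonneg_of_mem_rowStochastic (rowStochastic_pow hnn hrow k))) (fun k => ?_)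
      ((Real.summable_pow_div_factorial t).mul_left (Real.exp (-t)))
    rw [mul_div_assoc]
    exact mul_le_of_le_one_right (by positivity)
      (le_one_of_mem_rowStochastic (rowStochastic_pow hnn hrow k))
  have := hasSum_sum fun y (_ : y ∈ univ) => (hs y).hasSum.mul_right (h y)
  refine this.congr_fun fun k => ?_
  simp only [mulVec, dotProduct, mul_sum, mul_assoc]

/-- The generator of the heat semigroup is `K - 1`. -/
lemma abs_sum_heatKer_mul_sub_le (hnn : ∀ x y, 0 ≤ K x y) (hrow : ∀ x, ∑ y, K x y = 1)
    {t : ℝ} (ht : 0 ≤ t) (ht1 : t ≤ 1) {h : V → ℝ} {M : ℝ} (hM : ∀ x, |h x| ≤ M) (x : V) :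
    |∑ y, heatKer K t x y * h y - (h x + t * ((K *ᵥ h) x - h x))| ≤ 3 * M * t ^ 2 := by
  have hM0 : 0 ≤ M := (abs_nonneg _).trans (hM x)
  have hc := abs_pow_mulVec_le hnn hrow hM
  set c : ℕ → ℝ := fun k => (K ^ k *ᵥ h) x
  have hsum := hasSum_heatKer_mul hnn hrow ht h x
  rw [← hasSum_nat_add_iff' 2] at hsum
  have hexp : HasSum (fun k : ℕ => t ^ k / (Nat.factorial k : ℝ)) (Real.exp t) := by
    rw [Real.exp_eq_exp_ℝ]
    exact NormedSpace.expSeries_div_hasSum_exp t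
  rw [← hasSum_nat_add_iff' 2] at hexp
  have htail := tsum_of_norm_bounded (hexp.mul_left (Real.exp (-t) * M)) fun k => by
    change ‖Real.exp (-t) * t ^ (k + 2) / (Nat.factorial (k + 2) : ℝ) *
      (K ^ (k + 2) *ᵥ h) x‖ ≤ _
    rw [norm_mul, Real.norm_of_nonneg (by positivity), Real.norm_eq_abs]
    calc _ ≤ Real.exp (-t) * t ^ (k + 2) / (Nat.factorial (k + 2) : ℝ) * M :=
          mul_le_mul_of_nonneg_left (hc _ x) (by positivity)
      _ = _ := by ring
  rw [hsum.tsum_eq] at htail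
  simp only [sum_range_succ, range_zero, sum_empty, pow_zero, pow_one, one_mulVec, Nat.factorial,
    Real.norm_eq_abs] at htail
  have he1 : Real.exp t - 1 - t ≤ t ^ 2 := by
    have := Real.abs_exp_sub_one_sub_id_le (x := t) (by rwa [abs_of_nonneg ht])
    exact (le_abs_self _).trans this
  have he2 : Real.exp (-t) ≤ 1 := by simpa using ht
  have he3 : 1 - t ≤ Real.exp (-t) := by linarith [Real.add_one_le_exp (-t)]
  have he4 : Real.exp (-t) - 1 + t ≤ t ^ 2 := by
    have := Real.abs_exp_sub_one_sub_id_le (x := -t) (by rwa [abs_neg, abs_of_nonneg ht])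
    have := (le_abs_self _).trans this
    linarith [neg_sq t]
  have hK : |(K *ᵥ h) x| ≤ M := by simpa using hc 1 x
  have hx := hM x
  set S := ∑ y, heatKer K t x y * h y
  set e := Real.exp (-t)
  have hb1 : |(e - 1 + t) * h x| ≤ t ^ 2 * M := by
    rw [abs_mul, abs_of_nonneg (by linarith)]
    exact mul_le_mul he4 hx (abs_nonneg _) (by positivity)
  have hb2 : |t * (e - 1) * (K *ᵥ h) x| ≤ t ^ 2 * M := by
    rw [abs_mul, abs_mul, abs_of_nonneg ht, abs_of_nonpos (by linarith), pow_two]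
    exact mul_le_mul (mul_le_mul_of_nonneg_left (by linarith) ht) hK (abs_nonneg _)
      (by positivity)
  have hb3 : e * M * (Real.exp t - 1 - t) ≤ t ^ 2 * M := by
    calc e * M * (Real.exp t - 1 - t) ≤ 1 * M * t ^ 2 := by
          refine mul_le_mul (mul_le_mul_of_nonneg_right he2 hM0) he1 ?_ (by positivity)
          linarith [Real.add_one_le_exp t]
      _ = t ^ 2 * M := by ring
  push_cast at htail
  have h0 := htail.trans (le_of_eq_of_le (by ring) hb3)
  rw [abs_le] at h0 hb1 hb2 ⊢
  constructor <;> linarith [h0.1, h0.2, hb1.1, hb1.2, hb2.1, hb2.2]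

/-- The mean hitting times of the `δ`-skeletons converge to the solution of the Dirichlet
problem. -/
lemma tendsto_tsum_surv_heatKer (hnn : ∀ x y, 0 ≤ K x y) (hrow : ∀ x, ∑ y, K x y = 1)
    {h : V → ℝ} (h0 : ∀ x ∈ A, h x = 0) (h1 : ∀ x ∉ A, h x - (K *ᵥ h) x = 1) (x : V) :
    (∀ᶠ δ in nhdsWithin (0 : ℝ) (Set.Ioi 0), Summable fun N => surv (heatKer K δ) A N x) ∧
      Tendsto (fun δ => δ * ∑' N, surv (heatKer K δ) A N x)
        (nhdsWithin (0 : ℝ) (Set.Ioi 0)) (nhds (h x)) := by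
  have hh := expected_hitting_nonneg hnn hrow h0 h1
  set M : ℝ := ∑ x, h x
  have hhM (x : V) : h x ≤ M := single_le_sum (fun y _ => hh y) (mem_univ x)
  have hM0 : 0 ≤ M := sum_nonneg fun x _ => hh x
  set C : ℝ := 3 * M + 1
  have hC : 0 < C := by positivity
  have hev : ∀ᶠ δ in nhdsWithin (0 : ℝ) (Set.Ioi 0), 0 < δ ∧ δ ≤ 1 ∧ δ * C < 1 := by
    have h2 : ∀ᶠ δ in nhds (0 : ℝ), δ < 1 := eventually_lt_nhds one_pos
    have h3 : ∀ᶠ δ in nhds (0 : ℝ), δ < C⁻¹ := eventually_lt_nhds (by positivity)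
    filter_upwards [self_mem_nhdsWithin, nhdsWithin_le_nhds h2, nhdsWithin_le_nhds h3]
      with δ hδ h2 h3
    refine ⟨hδ, h2.le, ?_⟩
    calc δ * C < C⁻¹ * C := mul_lt_mul_of_pos_right h3 hC
      _ = 1 := inv_mul_cancel₀ hC.ne'
  have hgen {δ : ℝ} (hδ : 0 < δ) (hδ1 : δ ≤ 1) (x : V) (hx : x ∉ A) :
      |h x - ∑ y, heatKer K δ x y * h y - δ| ≤ C * δ ^ 2 := by
    have := abs_sum_heatKer_mul_sub_le hnn hrow hδ.le hδ1
      (fun x => by rw [abs_of_nonneg (hh x)]; exact hhM x) x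
    rw [show (K *ᵥ h) x - h x = -1 by linarith [h1 x hx]] at this
    rw [abs_sub_comm] at this
    have h2 : 3 * M * δ ^ 2 ≤ C * δ ^ 2 := mul_le_mul_of_nonneg_right (by simp [C]) (sq_nonneg δ)
    refine le_trans (le_of_eq ?_) (this.trans h2)
    congr 1
    ring
  have hlow {δ : ℝ} (hδ : 0 < δ) (hδ1 : δ ≤ 1) (x : V) (hx : x ∉ A) :
      δ * (1 - δ * C) ≤ h x - ∑ y, heatKer K δ x y * h y := by
    have := (abs_le.1 (hgen hδ hδ1 x hx)).1
    linarith
  have hup {δ : ℝ} (hδ : 0 < δ) (hδ1 : δ ≤ 1) (x : V) (hx : x ∉ A) :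
      h x - ∑ y, heatKer K δ x y * h y ≤ δ * (1 + δ * C) := by
    have := (abs_le.1 (hgen hδ hδ1 x hx)).2
    linarith
  have hH {δ : ℝ} (hδ : 0 < δ) := heatKer_nonneg hnn hrow hδ.le
  have hsumm {δ : ℝ} (hδ : 0 < δ) (hδ1 : δ ≤ 1) (hδC : δ * C < 1) :
      Summable fun N => surv (heatKer K δ) A N x :=
    summable_surv (hH hδ) (mul_pos hδ (by linarith)) hh (hlow hδ hδ1) x
  refine ⟨hev.mono fun δ hδ => hsumm hδ.1 hδ.2.1 hδ.2.2, ?_⟩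
  have hcont (s : ℝ) : Tendsto (fun δ => h x / (1 + s * (δ * C)))
      (nhdsWithin (0 : ℝ) (Set.Ioi 0)) (nhds (h x)) := by
    have : ContinuousAt (fun δ => h x / (1 + s * (δ * C))) 0 := by
      refine ContinuousAt.div (by fun_prop) (by fun_prop) (by simp)
    have := this.tendsto
    simp only [zero_mul, mul_zero, add_zero, div_one] at this
    exact this.mono_left nhdsWithin_le_nhds
  refine tendsto_of_tendsto_of_tendsto_of_le_of_le' (hcont 1) (hcont (-1)) ?_ ?_
  · filter_upwards [hev] with δ ⟨hδ, hδ1, hδC⟩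
    have hpos : 0 < 1 + 1 * (δ * C) := by positivity
    rw [div_le_iff₀ hpos]
    have := le_mul_tsum_surv (hH hδ) hhM h0 (hup hδ hδ1) (hsumm hδ hδ1 hδC)
    linarith
  · filter_upwards [hev] with δ ⟨hδ, hδ1, hδC⟩
    have hpos : 0 < 1 + -1 * (δ * C) := by linarith
    rw [le_div_iff₀ hpos]
    have := mul_tsum_surv_le (hH hδ) (mul_pos hδ (by linarith)) hh (hlow hδ hδ1) x
    linarith

end HeatKernel

end Skeleton

section HittingTime

open Finset Matrix
open scoped ENNReal

lemma sum_path_eq_surv {V : Type} [Fintype V] [DecidableEq V] (H : V → V → ℝ) (A : Finset V)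
    (N : ℕ) (x : V) :
    ∑ y : Fin (N + 1) → V, (if ∀ i, y i ∉ A then (if y 0 = x then (1 : ℝ) else 0) *
      ∏ i : Fin N, H (y i.castSucc) (y i.succ) else 0) = surv H A N x := by
  induction N generalizing x with
  | zero =>
    rw [Fintype.sum_equiv (Equiv.funUnique (Fin 1) V) _
      (fun v => if v ∉ A then (if v = x then (1 : ℝ) else 0) else 0) fun y => by simp]
    by_cases hx : x ∈ A
    · simp only [surv, hx, if_true]
      refine sum_eq_zero fun v _ => ?_
      by_cases hv : v = x
      · simp [hv, hx]
      · simp [hv]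
    · rw [sum_eq_single x (fun v _ hv => by simp [hv]) (by simp)]
      simp [surv, hx]
  | succ N ih =>
    rw [← (Fin.consEquiv fun _ : Fin (N + 2) => V).sum_comp, Fintype.sum_prod_type,
      sum_eq_single x]
    · by_cases hx : x ∈ A
      · simp [surv, hx, Fin.consEquiv, Fin.forall_fin_succ]
      · simp only [surv, hx, if_false]
        simp_rw [← ih, mul_sum]
        rw [sum_comm]
        refine sum_congr rfl fun y _ => ?_
        rw [sum_eq_single (y 0) (fun w _ hw => by simp [hw.symm]) (by simp)]
        by_cases hy : ∀ i, y i ∉ A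
        · have : ∀ i, (Fin.cons x y : Fin (N + 2) → V) i ∉ A :=
            Fin.forall_fin_succ.2 ⟨by simpa using hx, by simpa using hy⟩
          simp only [Fin.consEquiv, Equiv.coe_fn_mk, this, hy, if_true, Fin.cons_zero, one_mul,
            Fin.prod_univ_succ, Fin.castSucc_zero, Fin.cons_succ, ← Fin.succ_castSucc,
            not_false_eq_true, implies_true]
        · have : ¬ ∀ i, (Fin.cons x y : Fin (N + 2) → V) i ∉ A :=
            fun h => hy (by simpa using (Fin.forall_fin_succ.1 h).2)
          simp only [Fin.consEquiv, Equiv.coe_fn_mk, this, hy, if_false, mul_zero]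
    · intro z _ hz
      simp [Fin.consEquiv, hz]
    · simp

namespace CTMC

variable {V : Type} [Fintype V] [DecidableEq V] {K : Matrix V V ℝ}

attribute [local instance] CTMC.mΩ

/-- The event that the walk avoids `A` at the times `0, δ, …, N δ`. -/
def avoid (W : CTMC V K) (A : Finset V) (δ : ℝ) (N : ℕ) : Set W.Ω :=
  {ω | ∀ j ≤ N, W.X (j * δ) ω ∉ A}

/-- The hitting time of `A` by the `δ`-skeleton of the walk. -/
def skelHit (W : CTMC V K) (A : Finset V) (δ : ℝ) (ω : W.Ω) : ℝ≥0∞ :=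
  ∑' N, (W.avoid A δ N).indicator (fun _ => ENNReal.ofReal δ) ω

variable (W : CTMC V K) (A : Finset V)

lemma measurableSet_avoid (δ : ℝ) (N : ℕ) : MeasurableSet (W.avoid A δ N) := by
  have : W.avoid A δ N = ⋂ j ∈ Set.Iic N, ⋂ y ∈ A, {ω | W.X (j * δ) ω = y}ᶜ := by
    ext ω
    simp only [avoid, Set.mem_ofPred_eq, Set.mem_iInter, Set.mem_Iic, Set.mem_compl_iff]
    exact ⟨fun h j hj y hy he => h j hj (he ▸ hy), fun h j hj hy => h j hj _ hy rfl⟩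
  rw [this]
  exact MeasurableSet.biInter (Set.to_countable _) fun j _ =>
    MeasurableSet.biInter (Set.to_countable _) fun y _ => (W.measX _ y).compl

lemma measurable_skelHit (δ : ℝ) : Measurable (W.skelHit A δ) :=
  Measurable.tsum fun N => measurable_const.indicator (W.measurableSet_avoid A δ N)

lemma measure_avoid (hnn : ∀ x y, 0 ≤ K x y) (hrow : ∀ x, ∑ y, K x y = 1) {δ : ℝ} (hδ : 0 ≤ δ)
    (N : ℕ) (x : V) :
    W.P x (W.avoid A δ N) = ENNReal.ofReal (surv (heatKer K δ) A N x) := by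
  have hH := heatKer_nonneg hnn hrow hδ
  let t : Fin (N + 1) → ℝ := fun i => (i : ℕ) * δ
  let cyl (y : Fin (N + 1) → V) : Set W.Ω := {ω | ∀ i, W.X (t i) ω = y i}
  have hunion : W.avoid A δ N = ⋃ y ∈ univ.filter fun y : Fin (N + 1) → V => ∀ i, y i ∉ A,
      cyl y := by
    ext ω
    simp only [avoid, Set.mem_ofPred_eq, mem_filter, mem_univ, true_and, Set.mem_iUnion, cyl,
      exists_prop]
    constructor
    · intro h
      exact ⟨fun i => W.X (t i) ω, fun i => h i (Nat.le_of_lt_succ i.2), fun i => rfl⟩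
    · rintro ⟨y, hy, hyω⟩ j hj
      have := hyω ⟨j, Nat.lt_succ_of_le hj⟩
      change W.X (j * δ) ω = _ at this
      rw [this]
      exact hy _
  have hcyl (y : Fin (N + 1) → V) : MeasurableSet (cyl y) := by
    have : cyl y = ⋂ i, {ω | W.X (t i) ω = y i} := by
      ext ω
      simp [cyl]
    rw [this]
    exact MeasurableSet.iInter fun i => W.measX _ _
  have hmono : Monotone t := fun i j hij =>
    mul_le_mul_of_nonneg_right (Nat.cast_le.2 hij) hδ
  rw [hunion, measure_biUnion_finset _ fun y _ => hcyl y, ← sum_path_eq_surv, ← sum_filter,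
    ENNReal.ofReal_sum_of_nonneg]
  · refine sum_congr rfl fun y _ => ?_
    rw [W.fdd x N t hmono (by simp [t]) y]
    have ht (i : Fin N) : t i.succ - t i.castSucc = δ := by
      simp only [t, Fin.val_succ, Fin.val_castSucc]
      push_cast
      ring
    simp only [ht]
  · intro y _
    exact mul_nonneg (by split_ifs <;> norm_num) (prod_nonneg fun i _ => hH _ _)
  · intro y _ y' _ hne
    refine Set.disjoint_left.2 fun ω h h' => hne (funext fun i => ?_)
    exact (h i).symm.trans (h' i)

lemma lintegral_skelHit (hnn : ∀ x y, 0 ≤ K x y) (hrow : ∀ x, ∑ y, K x y = 1) {δ : ℝ}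
    (hδ : 0 ≤ δ) {x : V} (hs : Summable fun N => surv (heatKer K δ) A N x) :
    ∫⁻ ω, W.skelHit A δ ω ∂(W.P x) =
      ENNReal.ofReal (δ * ∑' N, surv (heatKer K δ) A N x) := by
  simp only [skelHit]
  rw [lintegral_tsum fun N =>
    (measurable_const.indicator (W.measurableSet_avoid A δ N)).aemeasurable]
  simp_rw [lintegral_indicator_const (W.measurableSet_avoid A δ _),
    W.measure_avoid A hnn hrow hδ]
  rw [ENNReal.tsum_mul_left, ENNReal.ofReal_mul hδ,
    ENNReal.ofReal_tsum_of_nonneg (fun N => surv_nonneg (heatKer_nonneg hnn hrow hδ) N x) hs]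

variable {W A}

lemma skelHit_le {δ : ℝ} {ω : W.Ω} {j : ℕ} (hj : W.X (j * δ) ω ∈ A) :
    W.skelHit A δ ω ≤ j * ENNReal.ofReal δ := by
  have h : ∀ N ∉ range j, (W.avoid A δ N).indicator (fun _ => ENNReal.ofReal δ) ω = 0 :=
    fun N hN => Set.indicator_of_notMem (show ω ∉ W.avoid A δ N from
      fun h => h j (by simpa using hN) hj) _
  rw [skelHit, tsum_eq_sum h]
  calc _ ≤ ∑ N ∈ range j, ENNReal.ofReal δ := sum_le_sum fun N _ =>
        Set.indicator_le_self (W.avoid A δ N) (fun _ => ENNReal.ofReal δ) ω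
    _ = _ := by simp

lemma exists_skelHit_eq {δ : ℝ} (hδ : 0 < δ) {ω : W.Ω} (h : W.skelHit A δ ω ≠ ⊤) :
    ∃ j : ℕ, W.X (j * δ) ω ∈ A ∧ W.skelHit A δ ω = j * ENNReal.ofReal δ := by
  classical
  have hex : ∃ j : ℕ, W.X (j * δ) ω ∈ A := by
    by_contra! hne
    refine h ?_
    have (N : ℕ) : (W.avoid A δ N).indicator (fun _ => ENNReal.ofReal δ) ω = ENNReal.ofReal δ :=
      Set.indicator_of_mem (show ω ∈ W.avoid A δ N from fun j _ => hne j) _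
    simp only [skelHit, this]
    exact ENNReal.tsum_const_eq_top_of_ne_zero (by simpa using hδ)
  refine ⟨Nat.find hex, Nat.find_spec hex, le_antisymm (skelHit_le (Nat.find_spec hex)) ?_⟩
  calc (Nat.find hex : ℝ≥0∞) * ENNReal.ofReal δ
      = ∑ N ∈ range (Nat.find hex), (W.avoid A δ N).indicator (fun _ => ENNReal.ofReal δ) ω := by
        rw [sum_congr rfl fun N hN => Set.indicator_of_mem (show ω ∈ W.avoid A δ N from
          fun j hj => Nat.find_min hex (hj.trans_lt (mem_range.1 hN))) _]
        simp
    _ ≤ W.skelHit A δ ω := ENNReal.sum_le_tsum _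

lemma hit_le {ω : W.Ω} {t : ℝ} (ht : 0 ≤ t) (h : W.X t ω ∈ A) : W.hit A ω ≤ t :=
  csInf_le ⟨0, fun _ hs => hs.1⟩ ⟨ht, h⟩

lemma hit_nonneg (ω : W.Ω) : 0 ≤ W.hit A ω :=
  Real.sInf_nonneg fun _ hs => hs.1

lemma X_hit_mem {ω : W.Ω} {t : ℝ} (ht : 0 ≤ t) (h : W.X t ω ∈ A) : W.X (W.hit A ω) ω ∈ A := by
  obtain ⟨ε, hε, hX⟩ := W.rightCts ω (W.hit A ω)
  obtain ⟨s, hs, hsε⟩ := exists_lt_of_csInf_lt (s := {t : ℝ | 0 ≤ t ∧ W.X t ω ∈ (A : Set V)})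
    ⟨t, ht, h⟩ (show W.hit A ω < W.hit A ω + ε by linarith)
  rw [← hX s (hit_le hs.1 hs.2) hsε]
  exact hs.2

/-- The hitting times of fine skeletons approximate the hitting time. -/
lemma tendsto_skelHit {ω : W.Ω} {t : ℝ} (ht : 0 ≤ t) (h : W.X t ω ∈ A) {δ : ℕ → ℝ}
    (hδ : ∀ m, 0 < δ m) (hlim : Tendsto δ atTop (nhds 0)) :
    Tendsto (fun m => W.skelHit A (δ m) ω) atTop (nhds (ENNReal.ofReal (W.hit A ω))) := by
  set T := W.hit A ω
  have hT0 : 0 ≤ T := hit_nonneg ω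
  obtain ⟨ε, hε, hX⟩ := W.rightCts ω T
  have hupper : Tendsto (fun m => ENNReal.ofReal (T + δ m)) atTop (nhds (ENNReal.ofReal T)) := by
    have := ENNReal.tendsto_ofReal (hlim.const_add T)
    simpa using this
  refine tendsto_of_tendsto_of_tendsto_of_le_of_le' tendsto_const_nhds hupper
    (Eventually.of_forall fun m => ?_) ?_
  · by_cases htop : W.skelHit A (δ m) ω = ⊤
    · rw [htop]
      exact le_top
    · obtain ⟨j, hj, hje⟩ := exists_skelHit_eq (hδ m) htop
      rw [hje, ← ENNReal.ofReal_natCast, ← ENNReal.ofReal_mul (Nat.cast_nonneg j)]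
      exact ENNReal.ofReal_le_ofReal (hit_le (by have := hδ m; positivity) hj)
  · filter_upwards [hlim.eventually (gt_mem_nhds hε)] with m hm
    have h1 : T ≤ ⌈T / δ m⌉₊ * δ m := (div_le_iff₀ (hδ m)).1 (Nat.le_ceil _)
    have h2 : ⌈T / δ m⌉₊ * δ m < T + δ m := by
      have := Nat.ceil_lt_add_one (div_nonneg hT0 (hδ m).le)
      calc ⌈T / δ m⌉₊ * δ m < (T / δ m + 1) * δ m := mul_lt_mul_of_pos_right this (hδ m)
        _ = T + δ m := by have := (hδ m).ne'; field_simp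
    have hmem : W.X (⌈T / δ m⌉₊ * δ m) ω ∈ A := by
      rw [hX _ h1 (by linarith)]
      exact X_hit_mem ht h
    refine (skelHit_le hmem).trans ?_
    rw [← ENNReal.ofReal_natCast, ← ENNReal.ofReal_mul (Nat.cast_nonneg _)]
    exact ENNReal.ofReal_le_ofReal h2.le

lemma skelHit_le_skelHit_mul_nat {δ : ℝ} (hδ : 0 < δ) {r : ℕ} (hr : 0 < r) (ω : W.Ω) :
    W.skelHit A δ ω ≤ W.skelHit A (r * δ) ω := by
  by_cases htop : W.skelHit A (r * δ) ω = ⊤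
  · rw [htop]
    exact le_top
  · obtain ⟨j, hj, hje⟩ := exists_skelHit_eq (by positivity) htop
    rw [hje, ENNReal.ofReal_mul (Nat.cast_nonneg r), ENNReal.ofReal_natCast, ← mul_assoc]
    have := skelHit_le (W := W) (A := A) (δ := δ) (ω := ω) (j := j * r)
      (by push_cast; rwa [mul_assoc])
    simpa using this

variable (W A)

/-- The expected hitting time solves the Dirichlet problem. -/
lemma ex_hit (hnn : ∀ x y, 0 ≤ K x y) (hrow : ∀ x, ∑ y, K x y = 1)
    {h : V → ℝ} (h0 : ∀ x ∈ A, h x = 0) (h1 : ∀ x ∉ A, h x - (K *ᵥ h) x = 1) (x : V) :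
    W.ex x (W.hit A) = h x := by
  have := W.prob x
  obtain ⟨hsumm, hlim⟩ := tendsto_tsum_surv_heatKer hnn hrow h0 h1 x
  obtain ⟨δ₀, hs₀, hδ₀ : 0 < δ₀⟩ := (hsumm.and self_mem_nhdsWithin).exists
  set δ : ℕ → ℝ := fun m => δ₀ / ((m : ℝ) + 1) with hδdef
  have hδ (m : ℕ) : 0 < δ m := by positivity
  have hδ0 : Tendsto δ atTop (nhds 0) := by
    have := (tendsto_one_div_add_atTop_nhds_zero_nat (𝕜 := ℝ)).const_mul δ₀
    simpa [hδdef, div_eq_mul_inv] using this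
  have hδ0' : Tendsto δ atTop (nhdsWithin 0 (Set.Ioi 0)) :=
    tendsto_nhdsWithin_iff.2 ⟨hδ0, Eventually.of_forall hδ⟩
  have hbound (m : ℕ) (ω : W.Ω) : W.skelHit A (δ m) ω ≤ W.skelHit A δ₀ ω := by
    have := skelHit_le_skelHit_mul_nat (A := A) (hδ m) m.succ_pos ω
    rwa [show ((m.succ : ℕ) : ℝ) * δ m = δ₀ by
      simp only [hδdef, Nat.succ_eq_add_one]
      push_cast
      field_simp] at this
  have hfin : ∫⁻ ω, W.skelHit A δ₀ ω ∂(W.P x) ≠ ⊤ := by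
    rw [W.lintegral_skelHit A hnn hrow hδ₀.le hs₀]
    exact ENNReal.ofReal_ne_top
  have hae : ∀ᵐ ω ∂(W.P x), Tendsto (fun m => W.skelHit A (δ m) ω) atTop
      (nhds (ENNReal.ofReal (W.hit A ω))) := by
    filter_upwards [ae_lt_top (W.measurable_skelHit A δ₀) hfin] with ω hω
    obtain ⟨j, hj, -⟩ := exists_skelHit_eq hδ₀ hω.ne
    exact tendsto_skelHit (by positivity) hj hδ hδ0
  have hmeas : AEMeasurable (W.hit A) (W.P x) := by
    have := aemeasurable_of_tendsto_metrizable_ae' (fun m =>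
      (W.measurable_skelHit A (δ m)).aemeasurable) hae
    refine this.ennreal_toReal.congr (Eventually.of_forall fun ω => ?_)
    exact ENNReal.toReal_ofReal (hit_nonneg ω)
  have hconv := tendsto_lintegral_of_dominated_convergence (W.skelHit A δ₀)
    (fun m => W.measurable_skelHit A (δ m)) (fun m => Eventually.of_forall (hbound m)) hfin hae
  have hconv2 : Tendsto (fun m => ∫⁻ ω, W.skelHit A (δ m) ω ∂(W.P x)) atTop
      (nhds (ENNReal.ofReal (h x))) := by
    refine (ENNReal.tendsto_ofReal (hlim.comp hδ0')).congr' ?_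
    filter_upwards [hδ0'.eventually hsumm] with m hm
    exact (W.lintegral_skelHit A hnn hrow (hδ m).le hm).symm
  rw [ex, integral_eq_lintegral_of_nonneg_ae (Eventually.of_forall hit_nonneg)
    hmeas.aestronglyMeasurable, tendsto_nhds_unique hconv hconv2,
    ENNReal.toReal_ofReal (expected_hitting_nonneg hnn hrow h0 h1 x)]

end CTMC

end HittingTime

section VertexTransitive

open Finset Matrix

variable {V : Type} [Fintype V] {G : SimpleGraph V}

lemma gDiam_pos (hc : G.Connected) (hV : 2 ≤ Fintype.card V) : 0 < gDiam G := by
  obtain ⟨x, y, hxy⟩ := Fintype.exists_pair_of_one_lt_card hV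
  exact (hc.pos_dist_of_ne hxy).trans_le
    (le_sup (f := fun p : V × V => G.dist p.1 p.2) (mem_univ (x, y)))

variable [DecidableRel G.Adj]

lemma degree_eq_of_isVertexTransitive (hG : IsVertexTransitive G) (x y : V) :
    G.degree x = G.degree y := by
  obtain ⟨φ, rfl⟩ := hG x y
  exact (φ.degree_eq x).symm

variable [DecidableEq V]

lemma transMat_nonneg (x y : V) : 0 ≤ transMat G x y := by
  simp only [transMat, of_apply]
  split_ifs <;> positivity

lemma sum_transMat {x : V} (hx : 0 < G.degree x) : ∑ y, transMat G x y = 1 := by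
  have : (G.degree x : ℝ) ≠ 0 := by positivity
  simp only [transMat, of_apply, ← sum_filter, sum_const, nsmul_eq_mul,
    ← SimpleGraph.neighborFinset_eq_filter, SimpleGraph.card_neighborFinset_eq_degree]
  exact mul_inv_cancel₀ this

lemma transMat_symm (hG : IsVertexTransitive G) (x y : V) : transMat G x y = transMat G y x := by
  simp only [transMat, of_apply, degree_eq_of_isVertexTransitive hG x y, G.adj_comm x y]

/-- The non-asymptotic comparison of the stationary and quasi-stationary mean hitting times. -/
lemma abs_epi_hit_sub_exw_hit_le (W : CTMC V (transMat G)) (hc : G.Connected)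
    (hG : IsVertexTransitive G) {d : ℕ} (hd : ∀ x, G.degree x ≤ d) {A : Finset V}
    (hA : A.Nonempty) (hcard : 2 * A.card ≤ Fintype.card V) {a : V → ℝ} {lam : ℝ}
    (hq : IsQSD (transMat G) A a lam) :
    |W.epi (W.hit A) - W.exw a (W.hit A)| ≤
      2 * A.card * d * W.exw a (W.hit A) / (Fintype.card V / (gDiam G : ℝ) ^ 2) := by
  have hk : 0 < A.card := hA.card_pos
  have hV : 2 ≤ Fintype.card V := by omega
  have : Nontrivial V := Fintype.one_lt_card_iff_nontrivial.1 hV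
  obtain ⟨v, hv⟩ := hA
  set r := G.degree v
  have hr (x : V) : G.degree x = r := degree_eq_of_isVertexTransitive hG x v
  have hr0 : 0 < r := hc.preconnected.degree_pos_of_nontrivial v
  have hsym := transMat_symm hG
  have hnn := transMat_nonneg (G := G)
  have hrow (x : V) : ∑ y, transMat G x y = 1 := sum_transMat (by rw [hr]; exact hr0)
  set τ : ℝ := r * (gDiam G : ℝ) ^ 2
  have hτ : 0 ≤ τ := by positivity
  have hP (f : V → ℝ) : ∑ x, ∑ y, (f x - f y) ^ 2 ≤
      2 * τ * Fintype.card V * ∑ x, f x * (f x - (transMat G *ᵥ f) x) := by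
    have := poincare_of_isVertexTransitive hc hG hr hr0 f
    rw [sum_sum_mul_sq_sub hsym hrow] at this
    linarith
  obtain ⟨h, h0, h1⟩ := exists_expected_hitting (by positivity) hP ⟨v, hv⟩
  have hpi : W.epi (W.hit A) = (Fintype.card V : ℝ)⁻¹ * ∑ x, h x := by
    simp only [CTMC.epi, W.ex_hit A hnn hrow h0 h1]
  have hqs : W.exw a (W.hit A) = ∑ x, a x * h x := by
    simp only [CTMC.exw, W.ex_hit A hnn hrow h0 h1]
  have hmain := hq.abs_expected_hitting_sub_le hsym hnn hrow hτ hP ⟨v, hv⟩ h0 h1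
  have hrate := hq.rate_le hsym hnn hrow
  have hlam := hq.rate_pos hsym (by positivity) hP ⟨v, hv⟩
  have hmean := hq.mul_sum_mul_expected_hitting hsym h0 h1
  rw [hpi, hqs]
  refine hmain.trans ?_
  set T := ∑ x, a x * h x
  have hD : 0 < (gDiam G : ℝ) := Nat.cast_pos.2 (gDiam_pos hc hV)
  have hcard' : 2 * (A.card : ℝ) ≤ Fintype.card V := by exact_mod_cast hcard
  have hn : 0 < (Fintype.card V : ℝ) := by
    have : 0 < Fintype.card V := by omega
    exact Nat.cast_pos.2 this
  have hT : 0 ≤ T := by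
    by_contra! hneg
    linarith [mul_neg_of_pos_of_neg hlam hneg]
  have hnT : (Fintype.card V : ℝ) ≤ 2 * A.card * T := by
    have h2 : lam * Fintype.card V ≤ 2 * A.card := by
      have := mul_le_mul_of_nonneg_left hcard' hlam.le
      linarith
    calc (Fintype.card V : ℝ) = (lam * Fintype.card V) * T := by
          rw [mul_right_comm, hmean, one_mul]
      _ ≤ 2 * A.card * T := mul_le_mul_of_nonneg_right h2 hT
  have hrd : (r : ℝ) ≤ d := Nat.cast_le.2 (hd v)
  rw [div_div_eq_mul_div, le_div_iff₀ hn]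
  calc τ * Fintype.card V ≤ (d * (gDiam G : ℝ) ^ 2) * (2 * A.card * T) :=
        mul_le_mul (mul_le_mul_of_nonneg_right hrd (by positivity)) hnT hn.le (by positivity)
    _ = _ := by ring

end VertexTransitive

/-- Lemma 2.7: uniformly over sets `A` of cardinality `k`,
`E_π(T_A) = E_α(T_A)(1 + O(1/f(n)))`, where `α` is the quasi-stationary distribution
associated with `A` and `f(n)` is defined by `n = D² f(n)`. -/
theorem stationary_vs_quasistationary_expectation
    (B : ℕ → GW) (d : ℕ) (hB : GoodSeq B d) (k : ℕ) (hk1 : 1 ≤ k) :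
    ∃ C : ℝ, 0 < C ∧ ∃ N : ℕ, ∀ n ≥ N, ∀ A : Finset (B n).V, A.card = k →
      ∀ (a : (B n).V → ℝ) (lam : ℝ), IsQSD (transMat (B n).G) A a lam →
        |(B n).W.epi ((B n).W.hit ↑A) - (B n).W.exw a ((B n).W.hit ↑A)| ≤
          C * (B n).W.exw a ((B n).W.hit ↑A) / (B n).fgrowth := by
  obtain ⟨hc, hG, hd, hsize, -⟩ := hB
  obtain ⟨N, hN⟩ := eventually_atTop.1 (hsize.eventually_ge_atTop (2 * k))
  refine ⟨2 * k * d + 1, by positivity, N, fun n hn A hA a lam hq => ?_⟩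
  have hAne : A.Nonempty := Finset.card_pos.1 (by omega)
  refine (abs_epi_hit_sub_exw_hit_le (B n).W (hc n) (hG n) (hd n) hAne
    (by rw [hA]; exact hN n hn) hq).trans ?_
  rw [hA]
  have hT : 0 ≤ (B n).W.exw a ((B n).W.hit ↑A) :=
    Finset.sum_nonneg fun x _ => mul_nonneg (hq.nonneg x)
      (integral_nonneg fun ω => CTMC.hit_nonneg ω)
  refine div_le_div_of_nonneg_right ?_ (by positivity)
  exact mul_le_mul_of_nonneg_right (by linarith) hT
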